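/- Local exponential stability of the gradient observer (Theorem 1): let h : ℝ³∖{0} → ℝ be smooth and 0-homogeneous, let k > 0, and assume the non-degeneracy condition: for every nonzero trace-free Δ ∈ sl(3,ℝ), ∫_{S²} ⟨∇h(x), Δx⟩² dσ(x) > 0. Define the correction map Δ : SL(3,ℝ) → ℝ^{3×3} by Δ(M) := k ∫_{S²} ( h(M⁻¹x) − h(x) ) · ( M⁻ᵀ ∇h(M⁻¹x) ) xᵀ dσ(x). Then the equilibrium E = I₃ of the autonomous system E′ = Δ(E)E on SL(3,ℝ) is locally exponentially stable: there exist δ > 0, c > 0 and λ > 0 such that every differentiable solution E : [0,∞) → SL(3,ℝ) of E′(t) = Δ(E(t))E(t) with ‖E(0) − I₃‖ < δ satisfies ‖E(t) − I₃‖ ≤ c e^{−λt} ‖E(0) − I₃‖ for all t ≥ 0. -/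

import Mathlib

open Matrix MeasureTheory
open scoped RealInnerProductSpace

noncomputable section

/-- Euclidean 3-space. -/
abbrev E3 := EuclideanSpace ℝ (Fin 3)
/-- Real 3×3 matrices. -/
abbrev M3 := Matrix (Fin 3) (Fin 3) ℝ
/-- The special linear group SL(3,ℝ). -/
abbrev SL3 := Matrix.SpecialLinearGroup (Fin 3) ℝ

/-- Matrix-vector product as a map on Euclidean 3-space. -/
def mopv (A : M3) (x : E3) : E3 :=
  (WithLp.equiv 2 (Fin 3 → ℝ)).symm (A.mulVec (WithLp.equiv 2 (Fin 3 → ℝ) x))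

lemma mopv_mopv (A B : M3) (x : E3) : mopv A (mopv B x) = mopv (A * B) x := by
  simp [mopv, Matrix.mulVec_mulVec]

lemma mopv_one (x : E3) : mopv 1 x = x := by simp [mopv]

lemma mopv_ne_zero (H : SL3) {x : E3} (hx : x ≠ 0) : mopv (↑H) x ≠ 0 := by
  intro h0
  apply hx
  have h1 : mopv ↑(H⁻¹) (mopv ↑H x) = x := by
    rw [mopv_mopv, ← Matrix.SpecialLinearGroup.coe_mul, inv_mul_cancel,
      Matrix.SpecialLinearGroup.coe_one, mopv_one]
  rw [h0] at h1
  simpa [mopv] using h1.symm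

/-- The unit sphere S² in Euclidean 3-space. -/
abbrev S2 : Set E3 := Metric.sphere (0 : E3) 1

lemma sphere_ne_zero {x : E3} (hx : x ∈ S2) : x ≠ 0 := by
  have h : ‖x‖ = 1 := mem_sphere_zero_iff_norm.mp hx
  intro h0; rw [h0] at h; simp at h

/-- The right action `ρ(H,x) = H⁻¹x/‖H⁻¹x‖` of SL(3,ℝ) on the unit sphere. -/
def ρS (H : SL3) (x : S2) : S2 :=
  ⟨‖mopv ↑(H⁻¹) ↑x‖⁻¹ • mopv ↑(H⁻¹) ↑x,
    mem_sphere_zero_iff_norm.mpr (norm_smul_inv_norm (mopv_ne_zero H⁻¹ (sphere_ne_zero x.2)))⟩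

/-- The standard surface measure on the unit sphere S² (total mass 4π). -/
def σ : Measure S2 := (volume : Measure E3).toSphere

/-- The Frobenius norm of a 3×3 real matrix, `‖A‖ = √tr(AᵀA)`. -/
def frobNorm (A : M3) : ℝ := Real.sqrt (∑ i, ∑ j, A i j ^ 2)

section

open Filter Topology

lemma mopv_eq_toEuclideanCLM (A : M3) (x : E3) :
    mopv A x = Matrix.toEuclideanCLM (n := Fin 3) (𝕜 := ℝ) A x := rfl

lemma continuous_toEuclideanCLM :
    Continuous fun A : M3 => Matrix.toEuclideanCLM (n := Fin 3) (𝕜 := ℝ) A :=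
  LinearMap.continuous_of_finiteDimensional
    (Matrix.toEuclideanCLM (n := Fin 3) (𝕜 := ℝ)).toAlgEquiv.toLinearMap

lemma continuous_mopv (A : M3) : Continuous (mopv A) :=
  (Matrix.toEuclideanCLM (n := Fin 3) (𝕜 := ℝ) A).continuous

lemma tendsto_mopv {ι : Type*} {l : Filter ι} {A : ι → M3} {A₀ : M3} {x : ι → E3} {x₀ : E3}
    (hA : Tendsto A l (𝓝 A₀)) (hx : Tendsto x l (𝓝 x₀)) :
    Tendsto (fun n => mopv (A n) (x n)) l (𝓝 (mopv A₀ x₀)) :=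
  (isBoundedBilinearMap_apply.continuous.tendsto
    (Matrix.toEuclideanCLM (n := Fin 3) (𝕜 := ℝ) A₀, x₀)).comp
      (((continuous_toEuclideanCLM.tendsto A₀).comp hA).prodMk_nhds hx)

lemma mopv_one_add_smul (Z : M3) (s : ℝ) (x : E3) : mopv (1 + s • Z) x = x + s • mopv Z x := by
  simp [mopv_eq_toEuclideanCLM]

/-- A convergent sequence of matrices acts boundedly on the unit sphere, uniformly. -/
lemma exists_norm_mopv_le {Z : ℕ → M3} {Z₀ : M3} (hZ : Tendsto Z atTop (𝓝 Z₀)) :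
    ∃ C, 0 < C ∧ ∀ n x, ‖mopv (Z n) x‖ ≤ C * ‖x‖ := by
  obtain ⟨C, hC⟩ := ((continuous_toEuclideanCLM.tendsto Z₀).comp hZ).norm.bddAbove_range
  refine ⟨max C 1, by positivity, fun n x => ?_⟩
  refine ((Matrix.toEuclideanCLM (n := Fin 3) (𝕜 := ℝ) (Z n)).le_opNorm x).trans ?_
  gcongr
  exact (hC ⟨n, rfl⟩).trans (le_max_left _ _)

lemma inner_gradient (h : E3 → ℝ) (x v : E3) : ⟪gradient h x, v⟫ = fderiv ℝ h x v := by
  simp [gradient]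

lemma norm_gradient (h : E3 → ℝ) (x : E3) : ‖gradient h x‖ = ‖fderiv ℝ h x‖ := by
  simp [gradient]

lemma continuousOn_gradient {h : E3 → ℝ} (hreg : ContDiffOn ℝ (⊤ : ℕ∞) h {(0 : E3)}ᶜ) :
    ContinuousOn (gradient h) {(0 : E3)}ᶜ :=
  (InnerProductSpace.toDual ℝ E3).symm.continuous.comp_continuousOn
    (hreg.continuousOn_fderiv_of_isOpen isOpen_compl_singleton (by simp))

lemma differentiableAt_of_contDiffOn_compl_zero {h : E3 → ℝ}
    (hreg : ContDiffOn ℝ (⊤ : ℕ∞) h {(0 : E3)}ᶜ) {x : E3} (hx : x ≠ 0) :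
    DifferentiableAt ℝ h x :=
  (hreg.contDiffAt (isOpen_compl_singleton.mem_nhds hx)).differentiableAt (by simp)

/-- The derivative is bounded near the unit sphere. -/
lemma exists_fderiv_bound {h : E3 → ℝ} (hreg : ContDiffOn ℝ (⊤ : ℕ∞) h {(0 : E3)}ᶜ) :
    ∃ C, 0 < C ∧ ∀ x : S2, ∀ y ∈ Metric.closedBall (x : E3) (1 / 2),
      y ≠ 0 ∧ ‖fderiv ℝ h y‖ ≤ C := by
  have hA : IsCompact (Metric.closedBall (0 : E3) (3 / 2) \ Metric.ball 0 (1 / 2)) :=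
    (isCompact_closedBall _ _).diff Metric.isOpen_ball
  have hA0 : Metric.closedBall (0 : E3) (3 / 2) \ Metric.ball 0 (1 / 2) ⊆ {(0 : E3)}ᶜ := by
    rintro y ⟨-, hy⟩ rfl
    simp at hy
  obtain ⟨C, hC⟩ := hA.exists_bound_of_continuousOn ((continuousOn_gradient hreg).mono hA0)
  refine ⟨max C 1, by positivity, fun x y hy => ?_⟩
  have hx : ‖(x : E3)‖ = 1 := mem_sphere_zero_iff_norm.mp x.2
  rw [mem_closedBall_iff_norm] at hy
  have h1 : ‖y‖ ≤ ‖(x : E3)‖ + ‖y - x‖ := norm_le_norm_add_norm_sub' y x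
  have h2 : ‖(x : E3)‖ ≤ ‖y‖ + ‖y - x‖ := norm_le_norm_add_norm_sub y x
  have hyA : y ∈ Metric.closedBall (0 : E3) (3 / 2) \ Metric.ball 0 (1 / 2) := by
    simp only [Set.mem_sdiff, mem_closedBall_zero_iff, mem_ball_zero_iff, not_lt]
    constructor <;> linarith
  exact ⟨hA0 hyA, norm_gradient h y ▸ (hC y hyA).trans (le_max_left _ _)⟩

lemma continuous_comp_mopv {F : Type*} [TopologicalSpace F] {g : E3 → F}
    (hg : ContinuousOn g {(0 : E3)}ᶜ) {N : M3} (hN : ∀ x : S2, mopv N x ≠ 0) :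
    Continuous fun x : S2 => g (mopv N x) :=
  hg.comp_continuous ((continuous_mopv N).comp continuous_subtype_val) hN

lemma continuous_comp_coe {F : Type*} [TopologicalSpace F] {g : E3 → F}
    (hg : ContinuousOn g {(0 : E3)}ᶜ) : Continuous fun x : S2 => g x :=
  hg.comp_continuous continuous_subtype_val fun x => sphere_ne_zero x.2

instance : IsFiniteMeasure σ := inferInstanceAs (IsFiniteMeasure (volume : Measure E3).toSphere)

/-- First-order expansion at the identity of the integral defining the correction map. -/
lemma tendsto_correction_integral {h : E3 → ℝ} (hreg : ContDiffOn ℝ (⊤ : ℕ∞) h {(0 : E3)}ᶜ)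
    {N Z : ℕ → M3} {Z₀ : M3} {s : ℕ → ℝ} (hs : ∀ n, 0 < s n) (hs0 : Tendsto s atTop (𝓝 0))
    (hZ : Tendsto Z atTop (𝓝 Z₀)) (hNZ : ∀ n, N n = 1 + s n • Z n)
    (hN0 : ∀ n, ∀ x : S2, mopv (N n) x ≠ 0) (i j : Fin 3) :
    Tendsto (fun n => (s n)⁻¹ * ∫ x : S2, (h (mopv (N n) x) - h x) *
        ((mopv ((N n)ᵀ) (gradient h (mopv (N n) x))) i * (x : E3) j) ∂σ) atTop
      (𝓝 (∫ x : S2, ⟪gradient h x, mopv Z₀ x⟫ * (gradient h x i * (x : E3) j) ∂σ)) := by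
  have hN : Tendsto N atTop (𝓝 1) := by
    simpa [← hNZ] using (tendsto_const_nhds (x := (1 : M3))).add (hs0.smul hZ)
  have hNt : Tendsto (fun n => (N n)ᵀ) atTop (𝓝 1) := by
    simpa [Function.comp_def] using
      (Continuous.matrix_transpose continuous_id).tendsto (1 : M3) |>.comp hN
  obtain ⟨C, hC, hCb⟩ := exists_fderiv_bound hreg
  obtain ⟨K, hK, hKb⟩ := exists_norm_mopv_le hZ
  obtain ⟨T, hT, hTb⟩ := exists_norm_mopv_le hNt
  simp_rw [← integral_const_mul]
  refine tendsto_integral_filter_of_dominated_convergence (fun _ => (C * K) * ((T * C) * 1))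
    (Eventually.of_forall fun n => ?_) ?_ (integrable_const _) (Eventually.of_forall fun x => ?_)
  · refine Continuous.aestronglyMeasurable ?_
    have h1 := continuous_comp_mopv hreg.continuousOn (hN0 n)
    have h2 := continuous_comp_coe hreg.continuousOn
    have h3 := (continuous_mopv (N n)ᵀ).comp
      (continuous_comp_mopv (continuousOn_gradient hreg) (hN0 n))
    have h4 := (EuclideanSpace.proj (𝕜 := ℝ) i).continuous.comp h3
    have h5 := (EuclideanSpace.proj (𝕜 := ℝ) j).continuous.comp
      (continuous_subtype_val : Continuous ((↑) : S2 → E3))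
    exact continuous_const.mul ((h1.sub h2).mul (h4.mul h5))
  · have hsK : ∀ᶠ n in atTop, s n * K < 1 / 2 := by
      have : Tendsto (fun n => s n * K) atTop (𝓝 0) := by simpa using hs0.mul_const K
      exact this.eventually_lt_const (by norm_num)
    filter_upwards [hsK] with n hn
    refine Eventually.of_forall fun x => ?_
    have hx : ‖(x : E3)‖ = 1 := mem_sphere_zero_iff_norm.mp x.2
    have hd : ‖mopv (N n) x - x‖ ≤ s n * K := by
      rw [hNZ, mopv_one_add_smul, add_sub_cancel_left, norm_smul, Real.norm_of_nonneg (hs n).le]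
      have := hKb n x
      rw [hx, mul_one] at this
      exact mul_le_mul_of_nonneg_left this (hs n).le
    have hmem : mopv (N n) x ∈ Metric.closedBall (x : E3) (1 / 2) := by
      rw [mem_closedBall_iff_norm]; linarith
    have hh : ‖h (mopv (N n) x) - h x‖ ≤ C * ‖mopv (N n) x - x‖ :=
      (convex_closedBall (x : E3) (1 / 2)).norm_image_sub_le_of_norm_fderiv_le
        (fun y hy => differentiableAt_of_contDiffOn_compl_zero hreg (hCb x y hy).1)
        (fun y hy => (hCb x y hy).2) (Metric.mem_closedBall_self (by norm_num)) hmem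
    have hg : ‖mopv (N n)ᵀ (gradient h (mopv (N n) x)) i‖ ≤ T * C := by
      refine (PiLp.norm_apply_le _ i).trans ((hTb n _).trans ?_)
      gcongr
      exact norm_gradient h _ ▸ (hCb x _ hmem).2
    have hxj : ‖(x : E3) j‖ ≤ 1 := hx ▸ PiLp.norm_apply_le (x : E3) j
    have hq : (s n)⁻¹ * ‖h (mopv (N n) x) - h x‖ ≤ C * K := by
      rw [inv_mul_le_iff₀ (hs n)]
      calc _ ≤ C * ‖mopv (N n) x - x‖ := hh
        _ ≤ C * (s n * K) := by gcongr
        _ = s n * (C * K) := by ring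
    rw [← mul_assoc, norm_mul, norm_mul, norm_mul, norm_inv, Real.norm_of_nonneg (hs n).le]
    exact mul_le_mul hq (mul_le_mul hg hxj (norm_nonneg _) (by positivity)) (by positivity)
      (by positivity)
  · have hx0 : (x : E3) ≠ 0 := sphere_ne_zero x.2
    have hZx : Tendsto (fun n => mopv (Z n) x) atTop (𝓝 (mopv Z₀ x)) :=
      tendsto_mopv hZ tendsto_const_nhds
    have hNx : Tendsto (fun n => mopv (N n) x) atTop (𝓝 (x : E3)) := by
      simpa [mopv_one] using tendsto_mopv hN (tendsto_const_nhds (x := (x : E3)))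
    have hdiff : Tendsto (fun n => (s n)⁻¹ * (h (mopv (N n) x) - h x)) atTop
        (𝓝 ⟪gradient h x, mopv Z₀ x⟫) := by
      rw [inner_gradient]
      have hf := (differentiableAt_of_contDiffOn_compl_zero hreg hx0).hasFDerivAt
      have := (hasFDerivWithinAt_univ.2 hf).lim (l := atTop) (c := fun n => (s n)⁻¹)
        (d := fun n => s n • mopv (Z n) x) (v := mopv Z₀ x)
        (by simpa using hs0.smul hZx) (by simp)
        (by simpa [smul_smul, inv_mul_cancel₀ (hs _).ne'] using hZx)
      simpa [hNZ, mopv_one_add_smul] using this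
    have hgr : Tendsto (fun n => mopv (N n)ᵀ (gradient h (mopv (N n) x))) atTop
        (𝓝 (gradient h x)) := by
      have h1 : Tendsto (fun n => gradient h (mopv (N n) x)) atTop (𝓝 (gradient h x)) :=
        (((continuousOn_gradient hreg).continuousAt
          (isOpen_compl_singleton.mem_nhds hx0)).tendsto).comp hNx
      simpa [mopv_one] using tendsto_mopv hNt h1
    have hgi : Tendsto (fun n => mopv (N n)ᵀ (gradient h (mopv (N n) x)) i) atTop
        (𝓝 (gradient h x i)) :=
      ((EuclideanSpace.proj (𝕜 := ℝ) i).continuous.tendsto (gradient h x)).comp hgr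
    simpa [mul_assoc] using hdiff.mul (hgi.mul_const ((x : E3) j))

lemma inner_mopv (v x : E3) (A : M3) :
    ⟪v, mopv A x⟫ = ∑ i, ∑ j, A i j * (v i * x j) := by
  simp only [mopv, PiLp.inner_apply, Matrix.mulVec, dotProduct, WithLp.equiv_apply,
    WithLp.equiv_symm_apply, RCLike.inner_apply, conj_trivial, Finset.sum_mul]
  exact Finset.sum_congr rfl fun i _ => Finset.sum_congr rfl fun j _ => by ring

lemma continuous_inner_gradient_mopv {h : E3 → ℝ}
    (hreg : ContDiffOn ℝ (⊤ : ℕ∞) h {(0 : E3)}ᶜ) (A : M3) :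
    Continuous fun x : S2 => ⟪gradient h x, mopv A x⟫ :=
  (continuous_comp_coe (continuousOn_gradient hreg)).inner
    ((continuous_mopv A).comp continuous_subtype_val)

lemma continuous_gradient_mul {h : E3 → ℝ}
    (hreg : ContDiffOn ℝ (⊤ : ℕ∞) h {(0 : E3)}ᶜ) (i j : Fin 3) :
    Continuous fun x : S2 => gradient h x i * (x : E3) j :=
  ((EuclideanSpace.proj (𝕜 := ℝ) i).continuous.comp
    (continuous_comp_coe (continuousOn_gradient hreg))).mul
      ((EuclideanSpace.proj (𝕜 := ℝ) j).continuous.comp continuous_subtype_val)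

lemma sum_mul_integral_inner_gradient {h : E3 → ℝ}
    (hreg : ContDiffOn ℝ (⊤ : ℕ∞) h {(0 : E3)}ᶜ) (A : M3) :
    ∑ i, ∑ j, A i j * ∫ x : S2, ⟪gradient h x, mopv A x⟫ * (gradient h x i * (x : E3) j) ∂σ =
      ∫ x : S2, ⟪gradient h x, mopv A x⟫ ^ 2 ∂σ := by
  have hint (i j : Fin 3) : Integrable (fun x : S2 =>
      A i j * (⟪gradient h x, mopv A x⟫ * (gradient h x i * (x : E3) j))) σ :=
    (continuous_const.mul ((continuous_inner_gradient_mopv hreg A).mul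
      (continuous_gradient_mul hreg i j))).integrable_of_hasCompactSupport
        (HasCompactSupport.of_compactSpace _)
  simp_rw [← integral_const_mul]
  simp_rw [← integral_finsetSum _ fun j _ => hint _ j]
  rw [← integral_finsetSum _ fun i _ => integrable_finsetSum _ fun j _ => hint i j]
  congr 1 with x
  calc _ = ⟪gradient h x, mopv A x⟫ * ∑ i, ∑ j, A i j * (gradient h x i * (x : E3) j) := by
        simp only [Finset.mul_sum]
        exact Finset.sum_congr rfl fun i _ => Finset.sum_congr rfl fun j _ => by ring
    _ = _ := (congrArg _ (inner_mopv _ _ _).symm).trans (sq _).symm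

lemma tendsto_matrix_iff {A : ℕ → M3} {A₀ : M3} :
    Tendsto A atTop (𝓝 A₀) ↔ ∀ i j, Tendsto (fun n => A n i j) atTop (𝓝 (A₀ i j)) := 
  tendsto_pi_nhds.trans (forall_congr' fun _ => tendsto_pi_nhds)

/-- Along matrices of `SL(3,ℝ)` approaching the identity in direction `Y₀`, the correction map is
asymptotic to minus the quadratic form of the non-degeneracy condition. -/
lemma tendsto_inner_correction {h : E3 → ℝ} (hreg : ContDiffOn ℝ (⊤ : ℕ∞) h {(0 : E3)}ᶜ)
    {k : ℝ} {Δc : SL3 → M3}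
    (hΔc : ∀ (M : SL3) (i j : Fin 3), Δc M i j =
      k * ∫ x : S2, (h (mopv ↑(M⁻¹) ↑x) - h ↑x) *
        ((mopv ((↑(M⁻¹) : M3)ᵀ) (gradient h (mopv ↑(M⁻¹) ↑x))) i * (↑x : E3) j) ∂σ)
    {M : ℕ → SL3} {Y : ℕ → M3} {Y₀ : M3} {s : ℕ → ℝ} (hs : ∀ n, 0 < s n)
    (hs0 : Tendsto s atTop (𝓝 0)) (hY : Tendsto Y atTop (𝓝 Y₀))
    (hMY : ∀ n, (M n : M3) = 1 + s n • Y n) :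
    Tendsto (fun n => ∑ i, ∑ j, Y n i j * ((s n)⁻¹ * (Δc (M n) * (M n : M3)) i j)) atTop
      (𝓝 (-(k * ∫ x : S2, ⟪gradient h x, mopv Y₀ x⟫ ^ 2 ∂σ))) := by
  have hM : Tendsto (fun n => (M n : M3)) atTop (𝓝 1) := by
    simpa [← hMY] using (tendsto_const_nhds (x := (1 : M3))).add (hs0.smul hY)
  have hN : Tendsto (fun n => ((M n)⁻¹ : SL3).1) atTop (𝓝 1) := by
    simpa [Function.comp_def, Matrix.SpecialLinearGroup.coe_inv] using
      (Continuous.matrix_adjugate continuous_id).tendsto (1 : M3) |>.comp hM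
  have hZ : Tendsto (fun n => -(((M n)⁻¹ : SL3).1 * Y n)) atTop (𝓝 (-Y₀)) := by
    simpa using (hN.mul hY).neg
  have hNZ (n : ℕ) : ((M n)⁻¹ : SL3).1 = 1 + s n • -(((M n)⁻¹ : SL3).1 * Y n) := by
    have h1 : ((M n)⁻¹ : SL3).1 * (M n).1 = 1 := by
      rw [← Matrix.SpecialLinearGroup.coe_mul, inv_mul_cancel, Matrix.SpecialLinearGroup.coe_one]
    rw [smul_neg, ← Matrix.mul_smul, ← sub_eq_iff_eq_add'.mpr (hMY n), Matrix.mul_sub, h1]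
    simp
  have hD : Tendsto (fun n => (s n)⁻¹ • Δc (M n)) atTop (𝓝 (Matrix.of fun i j =>
      k * ∫ x : S2, ⟪gradient h x, mopv (-Y₀) x⟫ * (gradient h x i * (x : E3) j) ∂σ)) := by
    refine tendsto_matrix_iff.2 fun i j => ?_
    have := (tendsto_correction_integral hreg hs hs0 hZ hNZ
      (fun n x => mopv_ne_zero _ (sphere_ne_zero x.2)) i j).const_mul k
    refine this.congr fun n => ?_
    rw [Matrix.smul_apply, hΔc, smul_eq_mul]
    ring
  have hP := tendsto_matrix_iff.1 (hD.mul hM)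
  have hsum := tendsto_finsetSum (Finset.univ : Finset (Fin 3)) fun i _ =>
    tendsto_finsetSum (Finset.univ : Finset (Fin 3)) fun j _ =>
      (tendsto_matrix_iff.1 hY i j).mul (hP i j)
  convert hsum using 2
  · simp
  · rw [mul_one, ← sum_mul_integral_inner_gradient hreg, Finset.mul_sum, ← Finset.sum_neg_distrib]
    refine Finset.sum_congr rfl fun i _ => ?_
    rw [Finset.mul_sum, ← Finset.sum_neg_distrib]
    refine Finset.sum_congr rfl fun j _ => ?_
    have hneg (x : S2) : ⟪gradient h x, mopv (-Y₀) x⟫ = -⟪gradient h x, mopv Y₀ x⟫ := by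
      simp [mopv_eq_toEuclideanCLM]
    simp only [Matrix.of_apply, hneg, neg_mul, integral_neg]
    ring

/-- Limit directions of unimodular matrices at the identity are trace-free. -/
lemma trace_eq_zero_of_tendsto {M : ℕ → SL3} {Y : ℕ → M3} {Y₀ : M3} {s : ℕ → ℝ}
    (hs : ∀ n, 0 < s n) (hs0 : Tendsto s atTop (𝓝 0)) (hY : Tendsto Y atTop (𝓝 Y₀))
    (hMY : ∀ n, (M n : M3) = 1 + s n • Y n) : Y₀.trace = 0 := by
  let e₂ : M3 → ℝ := fun A => A 0 0 * A 1 1 - A 0 1 * A 1 0 + (A 0 0 * A 2 2 - A 0 2 * A 2 0) +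
    (A 1 1 * A 2 2 - A 1 2 * A 2 1)
  have he₂ : Continuous e₂ := by fun_prop
  have htr (n : ℕ) : (Y n).trace = -(s n * e₂ (Y n) + s n ^ 2 * (Y n).det) := by
    have hdet := (M n).det_coe
    rw [hMY, Matrix.det_fin_three] at hdet
    refine mul_left_cancel₀ (hs n).ne' ?_
    rw [Matrix.trace_fin_three, Matrix.det_fin_three]
    simp at hdet
    simp only [e₂]
    linear_combination hdet
  have h1 : Tendsto (fun n => (Y n).trace) atTop (𝓝 Y₀.trace) :=
    ((Continuous.matrix_trace continuous_id).tendsto Y₀).comp hY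
  have h2 : Tendsto (fun n => -(s n * e₂ (Y n) + s n ^ 2 * (Y n).det)) atTop
      (𝓝 (-(0 * e₂ Y₀ + 0 ^ 2 * Y₀.det))) :=
    ((hs0.mul ((he₂.tendsto Y₀).comp hY)).add
      ((hs0.pow 2).mul (((Continuous.matrix_det continuous_id).tendsto Y₀).comp hY))).neg
  simp only [← htr] at h2
  simpa using tendsto_nhds_unique h1 h2

lemma frobNorm_nonneg (A : M3) : 0 ≤ frobNorm A := Real.sqrt_nonneg _

lemma sq_frobNorm (A : M3) : frobNorm A ^ 2 = ∑ i, ∑ j, A i j ^ 2 :=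
  Real.sq_sqrt (Finset.sum_nonneg fun _ _ => Finset.sum_nonneg fun _ _ => sq_nonneg _)

lemma abs_apply_le_frobNorm (A : M3) (i j : Fin 3) : |A i j| ≤ frobNorm A := by
  refine Real.abs_le_sqrt ?_
  exact (Finset.single_le_sum (f := fun j => A i j ^ 2) (fun _ _ => sq_nonneg _)
    (Finset.mem_univ j)).trans (Finset.single_le_sum (f := fun i => ∑ j, A i j ^ 2)
      (fun _ _ => Finset.sum_nonneg fun _ _ => sq_nonneg _) (Finset.mem_univ i))

lemma frobNorm_eq_zero {A : M3} : frobNorm A = 0 ↔ A = 0 := by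
  refine ⟨fun hA => ?_, fun hA => by simp [hA, frobNorm]⟩
  ext i j
  exact abs_nonpos_iff.1 (hA ▸ abs_apply_le_frobNorm A i j)

lemma frobNorm_smul (c : ℝ) (A : M3) : frobNorm (c • A) = |c| * frobNorm A := by
  rw [← sq_eq_sq₀ (frobNorm_nonneg _) (mul_nonneg (abs_nonneg _) (frobNorm_nonneg _)), mul_pow,
    sq_abs, sq_frobNorm, sq_frobNorm]
  simp [mul_pow, Finset.mul_sum]

lemma continuous_frobNorm : Continuous frobNorm := by
  unfold frobNorm
  fun_prop

lemma exists_subseq_tendsto_of_frobNorm_eq_one {Y : ℕ → M3} (hY : ∀ n, frobNorm (Y n) = 1) :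
    ∃ Y₀ : M3, frobNorm Y₀ = 1 ∧ ∃ φ : ℕ → ℕ, StrictMono φ ∧
      Tendsto (Y ∘ φ) atTop (𝓝 Y₀) := by
  have hK : IsCompact (Set.univ.pi fun _ : Fin 3 => Set.univ.pi fun _ : Fin 3 =>
      Set.Icc (-1 : ℝ) 1) :=
    isCompact_univ_pi fun _ => isCompact_univ_pi fun _ => isCompact_Icc
  obtain ⟨Y₀, -, φ, hφ, hlim⟩ := hK.tendsto_subseq (x := fun n i j => Y n i j) fun n i _ j _ =>
    abs_le.1 (hY n ▸ abs_apply_le_frobNorm (Y n) i j)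
  refine ⟨Y₀, ?_, φ, hφ, hlim⟩
  exact tendsto_nhds_unique ((continuous_frobNorm.tendsto Y₀).comp hlim)
    (tendsto_const_nhds.congr fun n => (hY (φ n)).symm)

/-- The squared distance to the identity is a strict local Lyapunov function. -/
lemma exists_lyapunov_bound {h : E3 → ℝ} (hreg : ContDiffOn ℝ (⊤ : ℕ∞) h {(0 : E3)}ᶜ)
    {k : ℝ} (hk : 0 < k)
    (hnd : ∀ Δ : M3, Δ ≠ 0 → Δ.trace = 0 →
      0 < ∫ x : S2, ⟪gradient h ↑x, mopv Δ ↑x⟫ ^ 2 ∂σ)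
    {Δc : SL3 → M3}
    (hΔc : ∀ (M : SL3) (i j : Fin 3), Δc M i j =
      k * ∫ x : S2, (h (mopv ↑(M⁻¹) ↑x) - h ↑x) *
        ((mopv ((↑(M⁻¹) : M3)ᵀ) (gradient h (mopv ↑(M⁻¹) ↑x))) i * (↑x : E3) j) ∂σ) :
    ∃ r > (0 : ℝ), ∃ α > (0 : ℝ), ∀ M : SL3, frobNorm ((M : M3) - 1) < r →
      ∑ i, ∑ j, ((M : M3) - 1) i j * (Δc M * (M : M3)) i j ≤
        -α * frobNorm ((M : M3) - 1) ^ 2 := by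
  by_contra! H
  have hpos (n : ℕ) : (0 : ℝ) < 1 / (n + 1) := by positivity
  choose M hMr hMα using fun n : ℕ => H _ (hpos n) _ (hpos n)
  set s : ℕ → ℝ := fun n => frobNorm ((M n : M3) - 1) with hs_def
  have hs (n : ℕ) : 0 < s n := by
    refine (frobNorm_nonneg _).lt_of_ne' fun h0 => ?_
    have := hMα n
    rw [h0, frobNorm_eq_zero.1 h0] at this
    simp at this
  have hs0 : Tendsto s atTop (𝓝 0) :=
    squeeze_zero (fun n => (hs n).le) (fun n => (hMr n).le)
      tendsto_one_div_add_atTop_nhds_zero_nat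
  set Y : ℕ → M3 := fun n => (s n)⁻¹ • ((M n : M3) - 1) with hY_def
  have hMY (n : ℕ) : (M n : M3) = 1 + s n • Y n := by
    simp [hY_def, smul_smul, (hs n).ne']
  have hY1 (n : ℕ) : frobNorm (Y n) = 1 := by
    simp only [hY_def, frobNorm_smul, abs_inv, abs_of_pos (hs n)]
    exact inv_mul_cancel₀ (hs n).ne'
  obtain ⟨Y₀, hY₀, φ, hφ, hlim⟩ := exists_subseq_tendsto_of_frobNorm_eq_one hY1
  have hsφ := hs0.comp hφ.tendsto_atTop
  have htr : Y₀.trace = 0 :=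
    trace_eq_zero_of_tendsto (M := M ∘ φ) (fun n => hs (φ n)) hsφ hlim fun n => hMY (φ n)
  have hY₀0 : Y₀ ≠ 0 := fun h0 => by
    rw [frobNorm_eq_zero.2 h0] at hY₀
    exact zero_ne_one hY₀
  have hQ := tendsto_inner_correction hreg hΔc (M := M ∘ φ) (fun n => hs (φ n)) hsφ hlim
    fun n => hMY (φ n)
  have hlow : Tendsto (fun n => -(1 / ((φ n : ℝ) + 1))) atTop (𝓝 (-0)) :=
    (tendsto_one_div_add_atTop_nhds_zero_nat.comp hφ.tendsto_atTop).neg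
  have hle := le_of_tendsto_of_tendsto' hlow hQ fun n => by
    have h1 := hMα (φ n)
    have h2 : 0 < s (φ n) := hs (φ n)
    have h3 : ∑ i, ∑ j, ((M (φ n) : M3) - 1) i j * (Δc (M (φ n)) * (M (φ n) : M3)) i j =
        s (φ n) ^ 2 * ∑ i, ∑ j, (Y ∘ φ) n i j *
          (((s ∘ φ) n)⁻¹ * (Δc ((M ∘ φ) n) * ((M ∘ φ) n : M3)) i j) := by
      simp only [Finset.mul_sum]
      refine Finset.sum_congr rfl fun i _ => Finset.sum_congr rfl fun j _ => ?_
      simp only [Function.comp_apply, hY_def, Matrix.smul_apply, smul_eq_mul]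
      field_simp
    rw [h3, mul_comm] at h1
    exact (lt_of_mul_lt_mul_left h1 (by positivity)).le
  have := mul_pos hk (hnd Y₀ hY₀0 htr)
  linarith

/-- A nonnegative function on `[0,∞)` whose derivative is at most `-2α` times itself as long as
it stays below `R` decays exponentially when started below `R`. -/
lemma le_mul_exp_of_deriv_le {V V' : ℝ → ℝ} {R α : ℝ} (hα : 0 < α)
    (hV0 : ∀ t, 0 ≤ V t)
    (hV : ∀ t ∈ Set.Ici (0 : ℝ), HasDerivWithinAt V (V' t) (Set.Ici 0) t)
    (hV' : ∀ t ∈ Set.Ici (0 : ℝ), V t < R → V' t ≤ -(2 * α) * V t)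
    (hR : V 0 < R) {t : ℝ} (ht : 0 ≤ t) : V t ≤ V 0 * Real.exp (-α * t) := by
  have key (ε : ℝ) (hε : V 0 < ε) (hεR : ε < R) : V t ≤ ε * Real.exp (-α * t) := by
    have hε0 : 0 < ε := (hV0 0).trans_lt hε
    have hB (x : ℝ) : HasDerivAt (fun t => ε * Real.exp (-α * t))
        (-α * (ε * Real.exp (-α * x))) x := by
      have := (((hasDerivAt_id x).const_mul (-α)).exp).const_mul ε
      simp only [id, mul_one] at this
      exact this.congr_deriv (by ring)
    refine image_le_of_deriv_right_lt_deriv_boundary' (a := 0) (b := t) (f := V) (f' := V')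
      (B := fun t => ε * Real.exp (-α * t))
      (fun x hx => (hV x hx.1).continuousWithinAt.mono Set.Icc_subset_Ici_self)
      (fun x hx => (hV x hx.1).mono (Set.Ici_subset_Ici.2 hx.1)) (by simpa using hε.le)
      (fun x _ => (hB x).continuousAt.continuousWithinAt)
      (fun x _ => (hB x).hasDerivWithinAt) (fun x hx hVx => ?_) ⟨ht, le_rfl⟩
    have hBpos : 0 < ε * Real.exp (-α * x) := by positivity
    have hexp : Real.exp (-α * x) ≤ 1 := Real.exp_le_one_iff.2 (by nlinarith [hx.1])
    have hlt : V x < R := by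
      rw [hVx]
      exact (mul_le_of_le_one_right hε0.le hexp).trans_lt hεR
    have := hV' x hx.1 hlt
    rw [← hVx] at hBpos ⊢
    nlinarith
  refine ge_of_tendsto (f := fun ε => ε * Real.exp (-α * t)) (x := 𝓝[>] (V 0)) ?_ ?_
  · exact ((continuous_id.mul continuous_const).tendsto (V 0)).mono_left nhdsWithin_le_nhds
  · filter_upwards [Ioo_mem_nhdsGT hR] with ε hε using key ε hε.1 hε.2

end

/-- local exponential stability of the gradient observer (Theorem 1):
under the non-degeneracy condition, the equilibrium `E = I₃` of `E′ = Δ(E)E` (with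
gradient correction `Δ(M) = k∫(h(M⁻¹x) − h(x))(M⁻ᵀ∇h(M⁻¹x))xᵀ dσ`) is locally
exponentially stable in the Frobenius norm. -/
theorem gradient_observer_local_exponential_stability (h : E3 → ℝ)
    (hreg : ContDiffOn ℝ (⊤ : ℕ∞) h {(0 : E3)}ᶜ)
    (hhom : ∀ c : ℝ, 0 < c → ∀ x : E3, x ≠ 0 → h (c • x) = h x)
    (k : ℝ) (hk : 0 < k)
    (hnd : ∀ Δ : M3, Δ ≠ 0 → Δ.trace = 0 →
      0 < ∫ x : S2, ⟪gradient h ↑x, mopv Δ ↑x⟫ ^ 2 ∂σ)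
    (Δc : SL3 → M3)
    (hΔc : ∀ (M : SL3) (i j : Fin 3), Δc M i j =
      k * ∫ x : S2, (h (mopv ↑(M⁻¹) ↑x) - h ↑x) *
        ((mopv ((↑(M⁻¹) : M3)ᵀ) (gradient h (mopv ↑(M⁻¹) ↑x))) i * (↑x : E3) j) ∂σ) :
    ∃ δ > (0 : ℝ), ∃ c > (0 : ℝ), ∃ lam > (0 : ℝ), ∀ E : ℝ → SL3,
      (∀ t ∈ Set.Ici (0 : ℝ), ∀ i j : Fin 3,
        HasDerivWithinAt (fun s => ((E s : M3)) i j)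
          ((Δc (E t) * (E t : M3)) i j) (Set.Ici (0 : ℝ)) t) →
      frobNorm ((E 0 : M3) - 1) < δ →
      ∀ t ≥ (0 : ℝ), frobNorm ((E t : M3) - 1) ≤
        c * Real.exp (-lam * t) * frobNorm ((E 0 : M3) - 1) := by
  obtain ⟨r, hr, α, hα, hbound⟩ := exists_lyapunov_bound hreg hk hnd hΔc
  refine ⟨r, hr, 1, one_pos, α / 2, half_pos hα, fun E hE hE0 t ht => ?_⟩
  have hV (t : ℝ) (ht : t ∈ Set.Ici (0 : ℝ)) :
      HasDerivWithinAt (fun s => frobNorm ((E s : M3) - 1) ^ 2)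
        (2 * ∑ i, ∑ j, ((E t : M3) - 1) i j * (Δc (E t) * (E t : M3)) i j) (Set.Ici 0) t := by
    simp only [sq_frobNorm, Finset.mul_sum]
    refine HasDerivWithinAt.fun_sum fun i _ => HasDerivWithinAt.fun_sum fun j _ => ?_
    have := ((hE t ht i j).sub_const ((1 : M3) i j)).fun_pow 2
    simpa [mul_assoc] using this
  have hdecay := le_mul_exp_of_deriv_le (R := r ^ 2) hα (fun _ => sq_nonneg _) hV
    (fun s _ hs => by
      have := hbound (E s) (lt_of_pow_lt_pow_left₀ 2 hr.le hs)
      linarith)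
    (pow_lt_pow_left₀ hE0 (frobNorm_nonneg _) two_ne_zero) ht
  refine le_of_sq_le_sq ?_ (mul_nonneg (by positivity) (frobNorm_nonneg _))
  rw [one_mul, mul_pow, ← Real.exp_nat_mul, mul_comm]
  have hexp : ((2 : ℕ) : ℝ) * (-(α / 2) * t) = -α * t := by push_cast; ring
  rwa [hexp]
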